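/- arXiv:1703.08812 — 3 statements merged into one kernel-verified Lean document; each statement's English description precedes it below -/
import Mathlib

section
/- (Johnson–Lindenstrauss Lemma, Dasgupta–Gupta bound) For any real ε with 0 < ε < 1 and any positive integer n, let k be a positive integer such that k ≥ 4 (ε²/2 − ε³/3)⁻¹ ln n. Then for any set V of n points in ℝᵈ there exists a map f : ℝᵈ → ℝᵏ such that for all u, v ∈ V, (1 − ε) ‖u − v‖² ≤ ‖f(u) − f(v)‖² ≤ (1 + ε) ‖u − v‖². -/
open MeasureTheory ProbabilityTheory Finset

lemma jl_log_upper {x : ℝ} (hx : 0 ≤ x) :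
    Real.log (1 + x) - x ≤ -(x ^ 2 / 2 - x ^ 3 / 3) := by
  have hm : MonotoneOn (fun y : ℝ => y - y ^ 2 / 2 + y ^ 3 / 3 - Real.log (1 + y)) (Set.Ici 0) := by
    have hd : ∀ y : ℝ, 0 ≤ y → HasDerivAt
        (fun y : ℝ => y - y ^ 2 / 2 + y ^ 3 / 3 - Real.log (1 + y))
        (y ^ 3 / (1 + y)) y := by
      intro y hy
      have h1 : (1 + y) ≠ 0 := by positivity
      have := (((hasDerivAt_id y).sub (((hasDerivAt_id y).pow 2).div_const 2)).add
        (((hasDerivAt_id y).pow 3).div_const 3)).sub (((hasDerivAt_id y).const_add 1).log h1)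
      refine HasDerivAt.congr_deriv this ?_
      simp only [id]
      field_simp
      ring
    apply monotoneOn_of_deriv_nonneg (convex_Ici 0)
    · intro y hy
      exact (hd y hy).continuousAt.continuousWithinAt
    · intro y hy
      rw [interior_Ici] at hy
      exact (hd y (le_of_lt hy)).differentiableAt.differentiableWithinAt
    · intro y hy
      rw [interior_Ici] at hy
      rw [(hd y (le_of_lt hy)).deriv]
      have : (0:ℝ) < y := hy
      positivity
  have := hm (Set.mem_Ici.2 le_rfl) (Set.mem_Ici.2 hx) hx
  simp at this
  linarith

lemma jl_log_lower {x : ℝ} (hx : 0 ≤ x) (hx1 : x < 1) :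
    Real.log (1 - x) + x ≤ -(x ^ 2 / 2 - x ^ 3 / 3) := by
  have h := Real.hasSum_pow_div_log_of_abs_lt_one (x := x) (by rwa [abs_of_nonneg hx])
  have h2 := sum_le_hasSum (Finset.range 2) (fun i _ => by positivity) h
  simp [Finset.sum_range_succ] at h2
  have : 0 ≤ x ^ 3 := by positivity
  norm_num at h2
  linarith

lemma jl_gauss (c : ℝ) (hc : 0 < c) :
    ∫ z, Real.exp ((1 - 1 / c) / 2 * (z ^ 2 - c)) ∂(gaussianReal 0 1)
      = Real.exp ((Real.log c - (c - 1)) / 2) := by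
  rw [integral_gaussianReal_eq_integral_smul one_ne_zero]
  have : ∀ z : ℝ, gaussianPDFReal 0 1 z • Real.exp ((1 - 1 / c) / 2 * (z ^ 2 - c))
      = ((√(2 * Real.pi))⁻¹ * Real.exp (-(c - 1) / 2)) * Real.exp (-(1 / (2 * c)) * z ^ 2) := by
    intro z
    simp only [gaussianPDFReal, smul_eq_mul, mul_assoc, ← Real.exp_add, NNReal.coe_one, mul_one]
    congr 2
    field_simp
    ring
  simp_rw [this]
  rw [integral_const_mul, integral_gaussian]
  have h1 : Real.pi / (1 / (2 * c)) = 2 * Real.pi * c := by field_simp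
  rw [h1, Real.sqrt_mul (x := 2 * Real.pi) (by positivity) c]
  have h2 : (Real.log c - (c - 1)) / 2 = Real.log c / 2 + (-(c - 1) / 2) := by ring
  rw [h2, Real.exp_add, Real.exp_half (Real.log c), Real.exp_log hc]
  have : √(2 * Real.pi) ≠ 0 := by positivity
  field_simp

lemma jl_law {d : ℕ} (w : EuclideanSpace ℝ (Fin d)) (hw : ‖w‖ = 1) :
    (stdGaussian (EuclideanSpace ℝ (Fin d))).map (fun g => inner ℝ w g) = gaussianReal 0 1 := by
  have := IsGaussian.map_eq_gaussianReal (μ := stdGaussian (EuclideanSpace ℝ (Fin d)))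
    (innerSL ℝ w)
  rw [variance_dual_stdGaussian, integral_strongDual_stdGaussian] at this
  simpa [hw] using this

noncomputable def jlS {d k : ℕ} (g : Fin k → EuclideanSpace ℝ (Fin d))
    (w : EuclideanSpace ℝ (Fin d)) : ℝ := ∑ i, (inner ℝ w (g i)) ^ 2

noncomputable def jlM (d k : ℕ) : Measure (Fin k → EuclideanSpace ℝ (Fin d)) :=
  Measure.pi (fun _ => stdGaussian (EuclideanSpace ℝ (Fin d)))

instance (d k : ℕ) : IsProbabilityMeasure (jlM d k) := by unfold jlM; infer_instance

lemma jl_mgf {d k : ℕ} (w : EuclideanSpace ℝ (Fin d)) (hw : ‖w‖ = 1) (c : ℝ) (hc : 0 < c) :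
    ∫ g, Real.exp ((1 - 1 / c) / 2 * (jlS g w - k * c)) ∂(jlM d k)
      = Real.exp (k / 2 * (Real.log c - (c - 1))) := by
  have h1 : ∀ g : Fin k → EuclideanSpace ℝ (Fin d),
      Real.exp ((1 - 1 / c) / 2 * (jlS g w - k * c)) =
      ∏ i, (fun x : EuclideanSpace ℝ (Fin d) =>
        Real.exp ((1 - 1 / c) / 2 * ((inner ℝ w x) ^ 2 - c))) (g i) := by
    intro g
    simp only [jlS]
    rw [← Real.exp_sum, ← Finset.mul_sum, Finset.sum_sub_distrib]
    simp
  simp_rw [h1]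
  rw [jlM, integral_fintype_prod_eq_pow (fun x : EuclideanSpace ℝ (Fin d) =>
        Real.exp ((1 - 1 / c) / 2 * ((inner ℝ w x) ^ 2 - c)))]
  have h2 : ∫ x, Real.exp ((1 - 1 / c) / 2 * ((inner ℝ w x) ^ 2 - c))
      ∂(stdGaussian (EuclideanSpace ℝ (Fin d))) = Real.exp ((Real.log c - (c - 1)) / 2) := by
    rw [← jl_gauss c hc, ← jl_law w hw, integral_map]
    · exact (Continuous.measurable (by fun_prop)).aemeasurable
    · exact (Continuous.measurable (by fun_prop)).aestronglyMeasurable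
  rw [h2, ← Real.exp_nat_mul]
  congr 1
  simp
  ring

lemma jl_int {d k : ℕ} (w : EuclideanSpace ℝ (Fin d)) (hw : ‖w‖ = 1) (c : ℝ) (hc : 0 < c) :
    Integrable (fun g => Real.exp ((1 - 1 / c) / 2 * (jlS g w - k * c))) (jlM d k) := by
  by_contra h
  have h1 := jl_mgf (k := k) w hw c hc
  rw [integral_undef h] at h1
  exact (Real.exp_pos _).ne h1

noncomputable def jlw {d : ℕ} (u v : EuclideanSpace ℝ (Fin d)) : EuclideanSpace ℝ (Fin d) :=
  (‖u - v‖⁻¹) • (u - v)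

lemma jlw_norm {d : ℕ} {u v : EuclideanSpace ℝ (Fin d)} (h : u ≠ v) : ‖jlw u v‖ = 1 := by
  have : ‖u - v‖ ≠ 0 := by rwa [norm_ne_zero_iff, sub_ne_zero]
  simp [jlw, norm_smul, this]

lemma jlS_symm {d k : ℕ} (g : Fin k → EuclideanSpace ℝ (Fin d))
    (u v : EuclideanSpace ℝ (Fin d)) : jlS g (jlw v u) = jlS g (jlw u v) := by
  have : jlw v u = - jlw u v := by
    simp only [jlw]
    rw [norm_sub_rev, ← smul_neg, neg_sub]
  simp [this, jlS]

lemma jlS_w {d k : ℕ} (g : Fin k → EuclideanSpace ℝ (Fin d))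
    {u v : EuclideanSpace ℝ (Fin d)} (h : u ≠ v) :
    jlS g (u - v) = ‖u - v‖ ^ 2 * jlS g (jlw u v) := by
  have : ‖u - v‖ ≠ 0 := by rwa [norm_ne_zero_iff, sub_ne_zero]
  simp only [jlS, jlw, Finset.mul_sum, real_inner_smul_left]
  refine Finset.sum_congr rfl fun i _ => ?_
  field_simp

noncomputable def jlPhi {d k : ℕ} (ε : ℝ) (p : EuclideanSpace ℝ (Fin d) × EuclideanSpace ℝ (Fin d))
    (g : Fin k → EuclideanSpace ℝ (Fin d)) : ℝ :=
  Real.exp ((1 - 1 / (1 + ε)) / 2 * (jlS g (jlw p.1 p.2) - k * (1 + ε))) +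
  Real.exp ((1 - 1 / (1 - ε)) / 2 * (jlS g (jlw p.1 p.2) - k * (1 - ε)))

/-- **Johnson–Lindenstrauss Lemma** (Dasgupta–Gupta bound). For any `0 < ε < 1` and any
positive integer `n`, if `k` is a positive integer with
`k ≥ 4 (ε²/2 − ε³/3)⁻¹ ln n`, then for any set `V` of `n` points in `ℝᵈ` there is a map
`f : ℝᵈ → ℝᵏ` such that for all `u, v ∈ V`,
`(1 − ε) ‖u − v‖² ≤ ‖f u − f v‖² ≤ (1 + ε) ‖u − v‖²`. -/
theorem johnson_lindenstrauss_dasgupta_gupta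
    (ε : ℝ) (hε0 : 0 < ε) (hε1 : ε < 1) (n : ℕ) (hn : 0 < n)
    (k : ℕ) (hk : 0 < k)
    (hkn : (k : ℝ) ≥ 4 * (ε ^ 2 / 2 - ε ^ 3 / 3)⁻¹ * Real.log n)
    (d : ℕ) (V : Finset (EuclideanSpace ℝ (Fin d))) (hV : V.card = n) :
    ∃ f : EuclideanSpace ℝ (Fin d) → EuclideanSpace ℝ (Fin k),
      ∀ u ∈ V, ∀ v ∈ V,
        (1 - ε) * ‖u - v‖ ^ 2 ≤ ‖f u - f v‖ ^ 2 ∧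
          ‖f u - f v‖ ^ 2 ≤ (1 + ε) * ‖u - v‖ ^ 2 := by
  classical
  set a : ℝ := ε ^ 2 / 2 - ε ^ 3 / 3 with ha
  have ha0 : 0 < a := by
    have : 0 < ε ^ 2 * (1 / 2 - ε / 3) := by
      apply mul_pos (by positivity); linarith
    rw [ha]; nlinarith
  have hn' : (0 : ℝ) < n := by exact_mod_cast hn
  have hka : 2 * Real.log n ≤ k / 2 * a := by
    have h1 : 4 * Real.log n = 4 * a⁻¹ * Real.log n * a := by field_simp
    have h2 : 4 * a⁻¹ * Real.log n * a ≤ k * a := mul_le_mul_of_nonneg_right hkn ha0.le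
    linarith
  have key : ∀ y : ℝ, y ≤ -a → Real.exp (k / 2 * y) ≤ 1 / (n : ℝ) ^ 2 := by
    intro y hy
    have h1 : (k : ℝ) / 2 * y ≤ -(2 * Real.log n) := by
      have : (k : ℝ) / 2 * y ≤ k / 2 * (-a) := mul_le_mul_of_nonneg_left hy (by positivity)
      linarith
    have h2 : Real.exp (-(2 * Real.log n)) = 1 / (n : ℝ) ^ 2 := by
      rw [Real.exp_neg, two_mul, Real.exp_add, Real.exp_log hn', one_div, sq]
    rw [← h2]
    exact Real.exp_le_exp.2 h1
  have hint : ∀ p ∈ V.offDiag, Integrable (jlPhi (k := k) ε p) (jlM d k) := by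
    intro p hp
    have hne := (Finset.mem_offDiag.1 hp).2.2
    exact (jl_int _ (jlw_norm hne) (1 + ε) (by linarith)).add
      (jl_int _ (jlw_norm hne) (1 - ε) (by linarith))
  have hval : ∀ p ∈ V.offDiag, ∫ g, jlPhi (k := k) ε p g ∂(jlM d k) ≤ 2 / (n : ℝ) ^ 2 := by
    intro p hp
    have hne := (Finset.mem_offDiag.1 hp).2.2
    simp only [jlPhi]
    rw [integral_add (jl_int _ (jlw_norm hne) (1 + ε) (by linarith))
      (jl_int _ (jlw_norm hne) (1 - ε) (by linarith)), jl_mgf _ (jlw_norm hne) _ (by linarith),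
      jl_mgf _ (jlw_norm hne) _ (by linarith)]
    have h1 := key (Real.log (1 + ε) - (1 + ε - 1)) (by
      have := jl_log_upper hε0.le; linarith)
    have h2 := key (Real.log (1 - ε) - (1 - ε - 1)) (by
      have := jl_log_lower hε0.le hε1; linarith)
    have h3 : 2 / (n : ℝ) ^ 2 = 1 / (n : ℝ) ^ 2 + 1 / (n : ℝ) ^ 2 := by ring
    linarith
  obtain ⟨g, hg⟩ : ∃ g : Fin k → EuclideanSpace ℝ (Fin d),
      ∑ p ∈ V.offDiag, jlPhi ε p g < 2 := by
    obtain ⟨g, hg⟩ := exists_le_integral (integrable_finsetSum V.offDiag hint)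
    refine ⟨g, lt_of_le_of_lt hg ?_⟩
    rw [integral_finsetSum _ hint]
    refine lt_of_le_of_lt (Finset.sum_le_sum hval) ?_
    rw [Finset.sum_const, Finset.offDiag_card, hV, nsmul_eq_mul, Nat.cast_sub (Nat.le_mul_self n)]
    push_cast
    rw [← mul_div_assoc, div_lt_iff₀ (by positivity)]
    nlinarith
  have hpos : ∀ p : EuclideanSpace ℝ (Fin d) × EuclideanSpace ℝ (Fin d), 0 < jlPhi ε p g := by
    intro p
    unfold jlPhi
    positivity
  have hk' : (0 : ℝ) < k := by exact_mod_cast hk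
  have hsep : ∀ u ∈ V, ∀ v ∈ V, u ≠ v →
      jlS g (jlw u v) < k * (1 + ε) ∧ k * (1 - ε) < jlS g (jlw u v) := by
    intro u hu v hv huv
    have h1 : ∑ p ∈ {(u, v), (v, u)}, jlPhi ε p g ≤ ∑ p ∈ V.offDiag, jlPhi ε p g := by
      apply Finset.sum_le_sum_of_subset_of_nonneg
      · intro p hp
        simp only [Finset.mem_insert, Finset.mem_singleton] at hp
        rcases hp with rfl | rfl
        · simp [hu, hv, huv]
        · simp [hu, hv, huv.symm]
      · intro p _ _
        exact (hpos p).le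
    rw [Finset.sum_pair (by simp [huv])] at h1
    have h2 : jlPhi ε (v, u) g = jlPhi ε (u, v) g := by
      simp only [jlPhi, jlS_symm g u v]
    have h3 : jlPhi ε (u, v) g < 1 := by linarith
    simp only [jlPhi] at h3
    have e1 := Real.exp_pos ((1 - 1 / (1 + ε)) / 2 * (jlS g (jlw u v) - k * (1 + ε)))
    have e2 := Real.exp_pos ((1 - 1 / (1 - ε)) / 2 * (jlS g (jlw u v) - k * (1 - ε)))
    have l1 := Real.exp_lt_one_iff.1 (by linarith :
      Real.exp ((1 - 1 / (1 + ε)) / 2 * (jlS g (jlw u v) - k * (1 + ε))) < 1)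
    have l2 := Real.exp_lt_one_iff.1 (by linarith :
      Real.exp ((1 - 1 / (1 - ε)) / 2 * (jlS g (jlw u v) - k * (1 - ε))) < 1)
    have t1 : 0 < (1 - 1 / (1 + ε)) / 2 := by
      have : 1 / (1 + ε) < 1 := by rw [div_lt_one (by linarith)]; linarith
      linarith
    have t2 : (1 - 1 / (1 - ε)) / 2 < 0 := by
      have : 1 < 1 / (1 - ε) := by rw [lt_div_iff₀ (by linarith)]; linarith
      linarith
    constructor
    · by_contra hcon
      have := mul_nonneg t1.le (sub_nonneg.2 (not_lt.1 hcon))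
      linarith
    · by_contra hcon
      have := mul_nonneg_of_nonpos_of_nonpos t2.le (sub_nonpos.2 (not_lt.1 hcon))
      linarith
  refine ⟨fun x => WithLp.toLp 2 (fun i => inner ℝ x (g i) / √k), ?_⟩
  intro u hu v hv
  have hnorm : ‖(WithLp.toLp 2 (fun i => inner ℝ u (g i) / √k) : EuclideanSpace ℝ (Fin k)) -
      WithLp.toLp 2 (fun i => inner ℝ v (g i) / √k)‖ ^ 2 = jlS g (u - v) / k := by
    rw [EuclideanSpace.norm_sq_eq, jlS, Finset.sum_div]
    refine Finset.sum_congr rfl fun i _ => ?_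
    simp only [PiLp.sub_apply, Real.norm_eq_abs, sq_abs, inner_sub_left]
    rw [← sub_div, div_pow, Real.sq_sqrt hk'.le]
  simp only [hnorm]
  rcases eq_or_ne u v with rfl | huv
  · simp [jlS]
  · obtain ⟨b1, b2⟩ := hsep u hu v hv huv
    rw [jlS_w g huv, le_div_iff₀ hk', div_le_iff₀ hk']
    have hq : 0 ≤ ‖u - v‖ ^ 2 := by positivity
    have c1 := mul_le_mul_of_nonneg_left b1.le hq
    have c2 := mul_le_mul_of_nonneg_left b2.le hq
    constructor <;> linarith
end

section
/- Let X and Y be independent real random variables with X ~ N(0, 1/k) (k > 0) and Y ~ N(μ_Y, σ_Y²) (σ_Y > 0), and set U = X e^Y. Then the law of U is absolutely continuous with respect to Lebesgue measure with density f_U(u) = (√k / (2π σ_Y)) ∫_{−∞}^{∞} exp( −y − k u² / (2 e^{2y}) − (y − μ_Y)² / (2 σ_Y²) ) dy. -/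
open MeasureTheory ProbabilityTheory Real

lemma nlm_pdf (k : ℝ) (hk : 0 < k) (σY : ℝ) (hσY : 0 < σY) (μY u y : ℝ) (v w : NNReal)
    (hv : (v : ℝ) = Real.exp y ^ 2 * (1 / k)) (hw : (w : ℝ) = σY ^ 2) :
    gaussianPDFReal μY w y * gaussianPDFReal 0 v u =
      Real.sqrt k / (2 * π * σY) * Real.exp (-y - k * u ^ 2 / (2 * Real.exp (2 * y))
            - (y - μY) ^ 2 / (2 * σY ^ 2)) := by
  have hk0 := hk.ne'
  have he := (Real.exp_pos y).ne'
  have hsk : Real.sqrt k ≠ 0 := (Real.sqrt_pos.2 hk).ne'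
  have hp : Real.sqrt π ^ 2 = π := Real.sq_sqrt Real.pi_pos.le
  have h2 : Real.sqrt 2 ^ 2 = 2 := Real.sq_sqrt (by norm_num)
  have e2 : Real.exp (2 * y) = Real.exp y ^ 2 := by rw [← Real.exp_nat_mul]; norm_num
  have A : Real.sqrt (2 * π * σY ^ 2) = Real.sqrt (2 * π) * σY := by
    rw [Real.sqrt_mul (by positivity), Real.sqrt_sq hσY.le]
  have B : Real.sqrt (2 * π * (Real.exp y ^ 2 * (1 / k))) =
      Real.sqrt (2 * π) * (Real.exp y / Real.sqrt k) := by
    rw [Real.sqrt_mul (by positivity), Real.sqrt_mul (sq_nonneg (Real.exp y)),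
      Real.sqrt_sq (Real.exp_pos y).le, Real.sqrt_div zero_le_one, Real.sqrt_one]
    ring
  have C : Real.sqrt (2 * π) * Real.sqrt (2 * π) = 2 * π :=
    Real.mul_self_sqrt (by positivity)
  rw [gaussianPDFReal_def, gaussianPDFReal_def, hv, hw, A, B]
  have E : -y - k * u ^ 2 / (2 * Real.exp (2 * y)) - (y - μY) ^ 2 / (2 * σY ^ 2) =
      -y + -(y - μY) ^ 2 / (2 * σY ^ 2) +
        -(u - 0) ^ 2 / (2 * (Real.exp y ^ 2 * (1 / k))) := by
    rw [e2]; field_simp; ring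
  rw [E, Real.exp_add, Real.exp_add, Real.exp_neg]
  have : Real.sqrt (2 * π) ≠ 0 := (Real.sqrt_pos.2 (by positivity)).ne'
  dsimp only
  generalize Real.exp (-(y - μY) ^ 2 / (2 * σY ^ 2)) = a
  generalize Real.exp (-(u - 0) ^ 2 / (2 * (Real.exp y ^ 2 * (1 / k)))) = b
  generalize Real.sqrt (2 * π) = r at *
  rw [← C]
  field_simp

lemma nlm_integrable (k : ℝ) (hk : 0 < k) (σY : ℝ) (hσY : 0 < σY) (μY u : ℝ) :
    Integrable (fun y : ℝ => Real.exp (-y - k * u ^ 2 / (2 * Real.exp (2 * y))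
            - (y - μY) ^ 2 / (2 * σY ^ 2))) := by
  have h := (integrable_gaussianPDFReal (μY - σY ^ 2) ((σY ^ 2).toNNReal)).const_mul
    (Real.sqrt (2 * π * σY ^ 2) * Real.exp (σY ^ 2 / 2 - μY))
  refine h.mono' (by fun_prop) (Filter.Eventually.of_forall fun y => ?_)
  rw [Real.norm_of_nonneg (Real.exp_pos _).le, gaussianPDFReal_def,
    Real.coe_toNNReal _ (sq_nonneg σY)]
  have hs : Real.sqrt (2 * π * σY ^ 2) ≠ 0 := (Real.sqrt_pos.2 (by positivity)).ne'
  dsimp only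
  have : Real.sqrt (2 * π * σY ^ 2) * Real.exp (σY ^ 2 / 2 - μY) *
      ((Real.sqrt (2 * π * σY ^ 2))⁻¹ *
        Real.exp (-(y - (μY - σY ^ 2)) ^ 2 / (2 * σY ^ 2))) =
      Real.exp (-y - (y - μY) ^ 2 / (2 * σY ^ 2)) := by
    have E : -y - (y - μY) ^ 2 / (2 * σY ^ 2) = (σY ^ 2 / 2 - μY) +
      -(y - (μY - σY ^ 2)) ^ 2 / (2 * σY ^ 2) := by field_simp; ring
    rw [E, Real.exp_add]
    field_simp
  rw [this]
  apply Real.exp_le_exp.2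
  have : 0 ≤ k * u ^ 2 / (2 * Real.exp (2 * y)) := by positivity
  linarith

/-- If `X ~ N(0, 1/k)` and `Y ~ N(μY, σY²)` are independent, then `U = X e^Y` (a normal
log-normal mixture) has law absolutely continuous w.r.t. Lebesgue measure with density
`f_U(u) = (√k / (2π σY)) ∫ exp(−y − k u²/(2 e^{2y}) − (y − μY)²/(2 σY²)) dy`. -/
theorem normal_lognormal_mixture_density
    {Ω : Type*} [MeasurableSpace Ω] (μ : Measure Ω) [IsProbabilityMeasure μ]
    (X Y : Ω → ℝ) (hX : Measurable X) (hY : Measurable Y)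
    (hindep : IndepFun X Y μ)
    (k : ℝ) (hk : 0 < k) (μY σY : ℝ) (hσY : 0 < σY)
    (hlawX : Measure.map X μ = gaussianReal 0 ((1 / k).toNNReal))
    (hlawY : Measure.map Y μ = gaussianReal μY ((σY ^ 2).toNNReal)) :
    Measure.map (fun ω => X ω * Real.exp (Y ω)) μ =
      volume.withDensity (fun u => ENNReal.ofReal
        (Real.sqrt k / (2 * π * σY) *
          ∫ y : ℝ, Real.exp (-y - k * u ^ 2 / (2 * Real.exp (2 * y))
            - (y - μY) ^ 2 / (2 * σY ^ 2)))) := by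
  have hw0 : (σY ^ 2).toNNReal ≠ 0 := (Real.toNNReal_pos.2 (by positivity)).ne'
  have hk1 : (1 / k).toNNReal ≠ 0 := (Real.toNNReal_pos.2 (by positivity)).ne'
  have hmap : Measure.map (fun ω => (X ω, Y ω)) μ =
      (gaussianReal 0 ((1 / k).toNNReal)).prod (gaussianReal μY ((σY ^ 2).toNNReal)) := by
    rw [(indepFun_iff_map_prod_eq_prod_map_map hX.aemeasurable hY.aemeasurable).1 hindep,
      hlawX, hlawY]
  have hf : Measurable (fun p : ℝ × ℝ => p.1 * Real.exp p.2) := by fun_prop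
  have hcomp : Measure.map (fun ω => X ω * Real.exp (Y ω)) μ =
      Measure.map (fun p : ℝ × ℝ => p.1 * Real.exp p.2)
        (Measure.map (fun ω => (X ω, Y ω)) μ) := by
    rw [Measure.map_map hf (hX.prodMk hY)]; rfl
  rw [hcomp, hmap]
  have hgm : Measurable (fun p : ℝ × ℝ => ENNReal.ofReal
      (Real.sqrt k / (2 * π * σY) *
        Real.exp (-p.2 - k * p.1 ^ 2 / (2 * Real.exp (2 * p.2))
            - (p.2 - μY) ^ 2 / (2 * σY ^ 2)))) := by fun_prop
  ext s hs
  rw [Measure.map_apply hf hs, Measure.prod_apply_symm (hf hs), withDensity_apply _ hs,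
    gaussianReal_of_var_ne_zero μY hw0,
    lintegral_withDensity_eq_lintegral_mul _ (measurable_gaussianPDF _ _)
      (measurable_measure_prodMk_right (hf hs))]
  have h1 : ∀ y : ℝ, (gaussianPDF μY ((σY ^ 2).toNNReal) * fun y =>
      (gaussianReal 0 ((1 / k).toNNReal))
        ((fun x => (x, y)) ⁻¹' ((fun p : ℝ × ℝ => p.1 * Real.exp p.2) ⁻¹' s))) y =
      ∫⁻ u in s, ENNReal.ofReal
      (Real.sqrt k / (2 * π * σY) *
        Real.exp (-y - k * u ^ 2 / (2 * Real.exp (2 * y))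
            - (y - μY) ^ 2 / (2 * σY ^ 2))) := by
    intro y
    have hset : (gaussianReal 0 ((1 / k).toNNReal))
        ((fun x => (x, y)) ⁻¹' ((fun p : ℝ × ℝ => p.1 * Real.exp p.2) ⁻¹' s)) =
        (gaussianReal 0 ((1 / k).toNNReal)).map (fun x => x * Real.exp y) s := by
      rw [Measure.map_apply (by fun_prop) hs]; rfl
    rw [Pi.mul_apply, hset, gaussianReal_map_mul_const, mul_zero, gaussianReal_apply _ (by
      refine mul_ne_zero ?_ hk1
      intro h
      have := congrArg NNReal.toReal h
      simp at this),
      ← lintegral_const_mul _ (measurable_gaussianPDF _ _)]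
    refine lintegral_congr fun u => ?_
    rw [gaussianPDF, gaussianPDF, ← ENNReal.ofReal_mul (gaussianPDFReal_nonneg _ _ _),
      nlm_pdf k hk σY hσY]
    · rw [NNReal.coe_mul, Real.coe_toNNReal _ (by positivity)]; rfl
    · exact Real.coe_toNNReal _ (by positivity)
  rw [lintegral_congr h1, lintegral_lintegral_swap
    (by exact (hgm.comp measurable_swap).aemeasurable)]
  refine lintegral_congr fun u => ?_
  rw [← integral_const_mul, ofReal_integral_eq_lintegral_ofReal
    ((nlm_integrable k hk σY hσY μY u).const_mul _)
    (Filter.Eventually.of_forall fun y => by positivity)]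
end

section
/- Let p ~ N(μ_p, Σ_p, a, b) and q ~ N(μ_q, Σ_q, c, d) be truncated multivariate normal distributions on ℝᵏ with symmetric positive definite covariance matrices Σ_p, Σ_q and componentwise truncation vectors a < b and c < d, such that in every coordinate the truncation intervals overlap (componentwise l < u where l = max(a,c) and u = min(b,d) componentwise). Then, with Σ = (Σ_p + Σ_q)/2 and m = [ (μ_pᵀ Σ_p⁻¹ + μ_qᵀ Σ_q⁻¹)(Σ_p⁻¹ + Σ_q⁻¹)⁻¹ ]ᵀ, the Bhattacharyya distance D_BC-TMN(p,q) = −ln ∫ √(f_p(x) f_q(x)) dx equals (1/8)(μ_p − μ_q)ᵀ Σ⁻¹ (μ_p − μ_q) + (1/2) ln( det Σ / √(det Σ_p det Σ_q) ) + (1/2) ln[ (2π)^{−k/2} (det Σ_p)^{−1/2} ∫_{a ≤ x ≤ b} exp(−(1/2)(x−μ_p)ᵀ Σ_p⁻¹ (x−μ_p)) dx ] + (1/2) ln[ (2π)^{−k/2} (det Σ_q)^{−1/2} ∫_{c ≤ x ≤ d} exp(−(1/2)(x−μ_q)ᵀ Σ_q⁻¹ (x−μ_q)) dx ] − ln[ (2π)^{−k/2}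 (det(Σ_p Σ⁻¹ Σ_q))^{−1/2} ∫_{l ≤ x ≤ u} exp( −(1/2)(x−m)ᵀ ( Σ_q⁻¹ Σ Σ_p⁻¹ ) (x−m) ) dx ]. -/
open MeasureTheory Real Matrix Classical

lemma quad_id_aux {k : ℕ} (P Q : Matrix (Fin k) (Fin k) ℝ) (hP : P.PosDef) (hQ : Q.PosDef)
    (y w : Fin k → ℝ) :
    (y - P *ᵥ w) ⬝ᵥ (P⁻¹ *ᵥ (y - P *ᵥ w)) + (y + Q *ᵥ w) ⬝ᵥ (Q⁻¹ *ᵥ (y + Q *ᵥ w)) =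
      y ⬝ᵥ ((P⁻¹ + Q⁻¹) *ᵥ y) + w ⬝ᵥ ((P + Q) *ᵥ w) := by
  have hPu : IsUnit P.det := hP.det_pos.ne'.isUnit
  have hQu : IsUnit Q.det := hQ.det_pos.ne'.isUnit
  have hPt : Pᵀ = P := by have := hP.isHermitian.eq; rwa [conjTranspose_eq_transpose_of_trivial] at this
  have hQt : Qᵀ = Q := by have := hQ.isHermitian.eq; rwa [conjTranspose_eq_transpose_of_trivial] at this
  have e1 : (P *ᵥ w) ⬝ᵥ (P⁻¹ *ᵥ y) = y ⬝ᵥ w := by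
    rw [dotProduct_mulVec, ← mulVec_transpose, mulVec_mulVec, transpose_nonsing_inv, hPt,
      nonsing_inv_mul _ hPu, one_mulVec, dotProduct_comm]
  have e2 : (Q *ᵥ w) ⬝ᵥ (Q⁻¹ *ᵥ y) = y ⬝ᵥ w := by
    rw [dotProduct_mulVec, ← mulVec_transpose, mulVec_mulVec, transpose_nonsing_inv, hQt,
      nonsing_inv_mul _ hQu, one_mulVec, dotProduct_comm]
  have f1 : P⁻¹ *ᵥ (P *ᵥ w) = w := by rw [mulVec_mulVec, nonsing_inv_mul _ hPu, one_mulVec]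
  have f2 : Q⁻¹ *ᵥ (Q *ᵥ w) = w := by rw [mulVec_mulVec, nonsing_inv_mul _ hQu, one_mulVec]
  simp only [mulVec_sub, mulVec_add, add_mulVec, sub_dotProduct, dotProduct_sub, add_dotProduct,
    dotProduct_add, e1, e2, f1, f2]
  rw [dotProduct_comm (P *ᵥ w) w, dotProduct_comm (Q *ᵥ w) w]
  ring

lemma int_pos_aux {k : ℕ} (M : Matrix (Fin k) (Fin k) ℝ) (a b v : Fin k → ℝ)
    (hab : ∀ i, a i < b i) :
    0 < ∫ x in Set.Icc a b, Real.exp (-(1 / 2) * ((x - v) ⬝ᵥ (M *ᵥ (x - v)))) := by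
  have hc : Continuous fun x : Fin k → ℝ => Real.exp (-(1 / 2) * ((x - v) ⬝ᵥ (M *ᵥ (x - v)))) := by
    fun_prop
  have hi := hc.continuousOn.integrableOn_compact (μ := volume) (isCompact_Icc (a := a) (b := b))
  rw [setIntegral_pos_iff_support_of_nonneg_ae (Filter.Eventually.of_forall
    fun x => (Real.exp_pos _).le) hi]
  have hs : (Function.support fun x : Fin k → ℝ =>
      Real.exp (-(1 / 2) * ((x - v) ⬝ᵥ (M *ᵥ (x - v))))) = Set.univ := by
    ext x; simp [Real.exp_ne_zero]
  rw [hs, Set.univ_inter, Real.volume_Icc_pi]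
  exact pos_iff_ne_zero.2 (Finset.prod_ne_zero_iff.2 fun i _ => by simp [hab i])

/-- The Bhattacharyya distance between two truncated multivariate normal distributions
`p ~ N(μp, Sp, a, b)` and `q ~ N(μq, Sq, c, d)` on `ℝᵏ` whose truncation boxes overlap
in every coordinate, expressed in terms of `S = (Sp + Sq)/2` and
`m = [(μpᵀ Sp⁻¹ + μqᵀ Sq⁻¹)(Sp⁻¹ + Sq⁻¹)⁻¹]ᵀ`. -/
theorem bhattacharyya_distance_truncated_multivariate_normal
    (k : ℕ) (μp μq : Fin k → ℝ) (Sp Sq : Matrix (Fin k) (Fin k) ℝ)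
    (hSp : Sp.PosDef) (hSq : Sq.PosDef)
    (a b c d : Fin k → ℝ) (hab : ∀ i, a i < b i) (hcd : ∀ i, c i < d i)
    (l u : Fin k → ℝ) (hl : l = fun i => max (a i) (c i))
    (hu : u = fun i => min (b i) (d i)) (hlu : ∀ i, l i < u i)
    (S : Matrix (Fin k) (Fin k) ℝ) (hS : S = (Sp + Sq) / 2)
    (m : Fin k → ℝ)
    (hm : m = (μp ᵥ* Sp⁻¹ + μq ᵥ* Sq⁻¹) ᵥ* (Sp⁻¹ + Sq⁻¹)⁻¹)
    (fp fq : (Fin k → ℝ) → ℝ)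
    (hfp : fp = fun x => if x ∈ Set.Icc a b then
        Real.exp (-(1 / 2) * ((x - μp) ⬝ᵥ (Sp⁻¹ *ᵥ (x - μp)))) /
          ∫ y in Set.Icc a b, Real.exp (-(1 / 2) * ((y - μp) ⬝ᵥ (Sp⁻¹ *ᵥ (y - μp))))
      else 0)
    (hfq : fq = fun x => if x ∈ Set.Icc c d then
        Real.exp (-(1 / 2) * ((x - μq) ⬝ᵥ (Sq⁻¹ *ᵥ (x - μq)))) /
          ∫ y in Set.Icc c d, Real.exp (-(1 / 2) * ((y - μq) ⬝ᵥ (Sq⁻¹ *ᵥ (y - μq))))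
      else 0) :
    -Real.log (∫ x : Fin k → ℝ, Real.sqrt (fp x * fq x)) =
      1 / 8 * ((μp - μq) ⬝ᵥ (S⁻¹ *ᵥ (μp - μq))) +
        1 / 2 * Real.log (S.det / Real.sqrt (Sp.det * Sq.det)) +
          1 / 2 * Real.log ((2 * π) ^ (-(k : ℝ) / 2) * Sp.det ^ (-(1 : ℝ) / 2) *
            ∫ x in Set.Icc a b, Real.exp (-(1 / 2) * ((x - μp) ⬝ᵥ (Sp⁻¹ *ᵥ (x - μp))))) +
          1 / 2 * Real.log ((2 * π) ^ (-(k : ℝ) / 2) * Sq.det ^ (-(1 : ℝ) / 2) *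
            ∫ x in Set.Icc c d, Real.exp (-(1 / 2) * ((x - μq) ⬝ᵥ (Sq⁻¹ *ᵥ (x - μq))))) -
          Real.log ((2 * π) ^ (-(k : ℝ) / 2) * (Sp * S⁻¹ * Sq).det ^ (-(1 : ℝ) / 2) *
            ∫ x in Set.Icc l u,
              Real.exp (-(1 / 2) * ((x - m) ⬝ᵥ ((Sq⁻¹ * S * Sp⁻¹) *ᵥ (x - m))))) := by
  have hPu : IsUnit Sp.det := hSp.det_pos.ne'.isUnit
  have hQu : IsUnit Sq.det := hSq.det_pos.ne'.isUnit
  have hT : (Sp + Sq).PosDef := hSp.add hSq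
  have hTu : IsUnit (Sp + Sq).det := hT.det_pos.ne'.isUnit
  have hS' : S = (1 / 2 : ℝ) • (Sp + Sq) := by
    have h2 : (2 : Matrix (Fin k) (Fin k) ℝ)⁻¹ = (1 / 2 : ℝ) • 1 := by
      apply inv_eq_left_inv
      have : (2 : Matrix (Fin k) (Fin k) ℝ) = (2 : ℝ) • 1 := by
        rw [two_smul]; exact one_add_one_eq_two.symm
      rw [this, smul_mul_smul_comm]; norm_num
    rw [hS, div_eq_mul_inv, h2]; simp
  have hSpd : S.PosDef := by rw [hS']; exact hT.smul (by norm_num)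
  have hSu : IsUnit S.det := hSpd.det_pos.ne'.isUnit
  obtain ⟨w, hw⟩ : ∃ w, w = (Sp + Sq)⁻¹ *ᵥ (μp - μq) := ⟨_, rfl⟩
  have hTw : (Sp + Sq) *ᵥ w = μp - μq := by
    rw [hw, mulVec_mulVec, mul_nonsing_inv _ hTu, one_mulVec]
  have hSw : S⁻¹ *ᵥ (μp - μq) = (2 : ℝ) • w := by
    have : μp - μq = S *ᵥ ((2 : ℝ) • w) := by
      rw [hS', smul_mulVec, mulVec_smul, smul_smul, hTw]; norm_num
    rw [this, mulVec_mulVec, nonsing_inv_mul _ hSu, one_mulVec]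
  have hPt : Sp⁻¹ᵀ = Sp⁻¹ := by
    have := hSp.inv.isHermitian.eq; rwa [conjTranspose_eq_transpose_of_trivial] at this
  have hQt : Sq⁻¹ᵀ = Sq⁻¹ := by
    have := hSq.inv.isHermitian.eq; rwa [conjTranspose_eq_transpose_of_trivial] at this
  have hABu : IsUnit (Sp⁻¹ + Sq⁻¹).det := (hSp.inv.add hSq.inv).det_pos.ne'.isUnit
  have hpq : μq + Sq *ᵥ w = μp - Sp *ᵥ w := by
    rw [add_mulVec] at hTw
    have := congrArg (fun z => μq + z - Sp *ᵥ w) hTw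
    rw [show μp - Sp *ᵥ w = μq + (μp - μq) - Sp *ᵥ w by abel, ← this]; abel
  have hmp : m = μp - Sp *ᵥ w := by
    have h1 : μp ᵥ* Sp⁻¹ + μq ᵥ* Sq⁻¹ = (μp - Sp *ᵥ w) ᵥ* (Sp⁻¹ + Sq⁻¹) := by
      rw [vecMul_add]
      nth_rewrite 2 [← hpq]
      rw [← mulVec_transpose, ← mulVec_transpose, ← mulVec_transpose, ← mulVec_transpose,
        hPt, hQt, mulVec_sub, mulVec_add, mulVec_mulVec, mulVec_mulVec, nonsing_inv_mul _ hPu,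
        nonsing_inv_mul _ hQu]
      abel
    rw [hm, h1, vecMul_vecMul, mul_nonsing_inv _ hABu, vecMul_one]
  have hmq : m = μq + Sq *ᵥ w := by rw [hmp, hpq]
  have hprec : Sq⁻¹ * S * Sp⁻¹ = (1 / 2 : ℝ) • (Sp⁻¹ + Sq⁻¹) := by
    rw [hS', mul_smul_comm, smul_mul_assoc, mul_add, add_mul, nonsing_inv_mul _ hQu, one_mul,
      mul_assoc, mul_nonsing_inv _ hPu, mul_one, add_comm]
  have hquad : ∀ x, (x - μp) ⬝ᵥ (Sp⁻¹ *ᵥ (x - μp)) + (x - μq) ⬝ᵥ (Sq⁻¹ *ᵥ (x - μq)) =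
      2 * ((x - m) ⬝ᵥ ((Sq⁻¹ * S * Sp⁻¹) *ᵥ (x - m))) +
      1 / 2 * ((μp - μq) ⬝ᵥ (S⁻¹ *ᵥ (μp - μq))) := by
    intro x
    have h := quad_id_aux Sp Sq hSp hSq (x - m) w
    rw [show x - m - Sp *ᵥ w = x - μp by rw [hmp]; abel,
      show x - m + Sq *ᵥ w = x - μq by rw [hmq]; abel] at h
    rw [h, hprec, hSw, hTw, smul_mulVec, dotProduct_smul, dotProduct_smul,
      dotProduct_comm w]
    simp only [smul_eq_mul]; ring
  have hZp := int_pos_aux Sp⁻¹ a b μp hab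
  have hZq := int_pos_aux Sq⁻¹ c d μq hcd
  have hI := int_pos_aux (Sq⁻¹ * S * Sp⁻¹) l u m hlu
  set Zp := ∫ x in Set.Icc a b, Real.exp (-(1 / 2) * ((x - μp) ⬝ᵥ (Sp⁻¹ *ᵥ (x - μp)))) with hZpd
  set Zq := ∫ x in Set.Icc c d, Real.exp (-(1 / 2) * ((x - μq) ⬝ᵥ (Sq⁻¹ *ᵥ (x - μq)))) with hZqd
  set I := ∫ x in Set.Icc l u,
    Real.exp (-(1 / 2) * ((x - m) ⬝ᵥ ((Sq⁻¹ * S * Sp⁻¹) *ᵥ (x - m)))) with hId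
  set D := (μp - μq) ⬝ᵥ (S⁻¹ *ᵥ (μp - μq)) with hD
  have hmem : ∀ x, x ∈ Set.Icc l u ↔ x ∈ Set.Icc a b ∧ x ∈ Set.Icc c d := by
    intro x
    simp only [hl, hu, Set.mem_Icc, Pi.le_def, max_le_iff, le_min_iff, forall_and]
    tauto
  have hfun : (fun x => Real.sqrt (fp x * fq x)) = (Set.Icc l u).indicator
      (fun x => (Real.exp (-(1 / 8) * D) / Real.sqrt (Zp * Zq)) *
        Real.exp (-(1 / 2) * ((x - m) ⬝ᵥ ((Sq⁻¹ * S * Sp⁻¹) *ᵥ (x - m))))) := by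
    funext x
    by_cases hx : x ∈ Set.Icc l u
    · obtain ⟨h1, h2⟩ := (hmem x).1 hx
      rw [Set.indicator_of_mem hx, hfp, hfq]
      simp only [if_pos h1, if_pos h2]
      rw [div_mul_div_comm, Real.sqrt_div (by positivity), ← Real.exp_add, ← Real.exp_half,
        div_mul_eq_mul_div, ← Real.exp_add]
      congr 2
      linear_combination (-1 / 4) * hquad x
    · rw [Set.indicator_of_notMem hx, hfp, hfq]
      rw [hmem] at hx
      by_cases h1 : x ∈ Set.Icc a b
      · have h2 : x ∉ Set.Icc c d := fun h => hx ⟨h1, h⟩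
        simp only [if_neg h2, mul_zero, Real.sqrt_zero]
      · simp only [if_neg h1, zero_mul, Real.sqrt_zero]
  rw [hfun, integral_indicator measurableSet_Icc, integral_const_mul, ← hId]
  have dp := hSp.det_pos
  have dq := hSq.det_pos
  have ds := hSpd.det_pos
  have hdet : (Sp * S⁻¹ * Sq).det = Sp.det * S.det⁻¹ * Sq.det := by
    rw [det_mul, det_mul, det_nonsing_inv, Ring.inverse_eq_inv']
  rw [hdet]
  have h2pi : (0 : ℝ) < 2 * π := by positivity
  have p0 : (0 : ℝ) < (2 * π) ^ (-(k : ℝ) / 2) := Real.rpow_pos_of_pos h2pi _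
  have p1 : 0 < Sp.det ^ (-(1 : ℝ) / 2) := Real.rpow_pos_of_pos dp _
  have p2 : 0 < Sq.det ^ (-(1 : ℝ) / 2) := Real.rpow_pos_of_pos dq _
  have dr : 0 < Sp.det * S.det⁻¹ * Sq.det := by positivity
  have p3 : 0 < (Sp.det * S.det⁻¹ * Sq.det) ^ (-(1 : ℝ) / 2) := Real.rpow_pos_of_pos dr _
  have s1 : 0 < Real.sqrt (Zp * Zq) := Real.sqrt_pos.2 (by positivity)
  have s2 : 0 < Real.sqrt (Sp.det * Sq.det) := Real.sqrt_pos.2 (by positivity)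
  rw [Real.log_mul (by positivity) hI.ne', Real.log_div (Real.exp_pos _).ne' s1.ne', Real.log_exp,
    Real.log_sqrt (by positivity), Real.log_mul hZp.ne' hZq.ne',
    Real.log_div ds.ne' s2.ne', Real.log_sqrt (by positivity), Real.log_mul dp.ne' dq.ne',
    Real.log_mul (by positivity) hZp.ne', Real.log_mul p0.ne' p1.ne',
    Real.log_mul (by positivity) hZq.ne', Real.log_mul p0.ne' p2.ne',
    Real.log_mul (by positivity) hI.ne', Real.log_mul p0.ne' p3.ne',
    Real.log_rpow dp, Real.log_rpow dq, Real.log_rpow dr,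
    Real.log_mul (by positivity) dq.ne', Real.log_mul dp.ne' (by positivity), Real.log_inv]
  ring
end
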